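/- For every ε ≥ 0, the following five sets of type-wise distributions coincide: Π_SF^ε ∩ Π_Prod, Π_ANF^ε ∩ Π_Prod, Π_Com^ε ∩ Π_Prod, Π_BS^ε ∩ Π_Prod, and Π_BNE^ε (the set of ε-approximate Bayes Nash equilibria in the agent normal form). -/

import Mathlib

open Finset
open scoped Classical

noncomputable section

/-- `f` is a probability distribution on the finite set `X`. -/
def IsDist {X : Type*} [Fintype X] (f : X → ℝ) : Prop :=
  (∀ x, f x ∈ Set.Icc (0 : ℝ) 1) ∧ ∑ x, f x = 1

variable {ι : Type*} [Fintype ι] [Nonempty ι]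
  {Θ A : ι → Type*}
  [∀ i, Fintype (Θ i)] [∀ i, Nonempty (Θ i)]
  [∀ i, Fintype (A i)] [∀ i, Nonempty (A i)]

/-- The map `η : Δ(S) → Δ(A)^Θ` : `η(σ)(θ;a) = ∑_{s : s(θ) = a} σ(s)`. -/
def eta (σ : ((i : ι) → Θ i → A i) → ℝ) :
    ((i : ι) → Θ i) → ((i : ι) → A i) → ℝ :=
  fun θ a => ∑ s : (i : ι) → Θ i → A i, if (fun i => s i (θ i)) = a then σ s else 0

/-- `π ∈ Π_Prod` : type-wise product distributions. -/
def PiProd : Set (((i : ι) → Θ i) → ((i : ι) → A i) → ℝ) :=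
  {π | ∃ p : (i : ι) → Θ i → A i → ℝ,
    (∀ i θi, IsDist (p i θi)) ∧ ∀ θ a, π θ a = ∏ i, p i (θ i) (a i)}

/-- ε-approximate strategic-form correlated equilibrium (incentive constraints). -/
def IsSFCE (ρ : ((i : ι) → Θ i) → ℝ)
    (v : (i : ι) → ((j : ι) → Θ j) → ((j : ι) → A j) → ℝ) (ε : ℝ)
    (σ : ((i : ι) → Θ i → A i) → ℝ) : Prop :=
  ∀ (i : ι) (φ : (Θ i → A i) → Θ i → A i),
    ∑ θ, ρ θ * ∑ s : (j : ι) → Θ j → A j, σ s * v i θ (fun j => s j (θ j)) ≥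
      ∑ θ, ρ θ * ∑ s : (j : ι) → Θ j → A j,
        σ s * v i θ (Function.update (fun j => s j (θ j)) i (φ (s i) (θ i))) - ε

/-- ε-approximate agent-normal-form correlated equilibrium (incentive constraints). -/
def IsANFCE (ρ : ((i : ι) → Θ i) → ℝ)
    (v : (i : ι) → ((j : ι) → Θ j) → ((j : ι) → A j) → ℝ) (ε : ℝ)
    (σ : ((i : ι) → Θ i → A i) → ℝ) : Prop :=
  ∀ (i : ι) (φ : Θ i → A i → A i),
    ∑ θ, ρ θ * ∑ s : (j : ι) → Θ j → A j, σ s * v i θ (fun j => s j (θ j)) ≥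
      ∑ θ, ρ θ * ∑ s : (j : ι) → Θ j → A j,
        σ s * v i θ (Function.update (fun j => s j (θ j)) i (φ (θ i) (s i (θ i)))) - ε

/-- Communication-equilibrium incentive constraints. -/
def CommIncentive (ρ : ((i : ι) → Θ i) → ℝ)
    (v : (i : ι) → ((j : ι) → Θ j) → ((j : ι) → A j) → ℝ) (ε : ℝ)
    (π : ((i : ι) → Θ i) → ((i : ι) → A i) → ℝ) : Prop :=
  ∀ (i : ι) (ψ : Θ i → Θ i) (φ : Θ i → A i → A i),
    ∑ θ, ρ θ * ∑ a : (j : ι) → A j, π θ a * v i θ a ≥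
      ∑ θ, ρ θ * ∑ a : (j : ι) → A j,
        π (Function.update θ i (ψ (θ i))) a *
          v i θ (Function.update a i (φ (θ i) (a i))) - ε

/-- Bayesian-solution incentive constraints. -/
def BSIncentive (ρ : ((i : ι) → Θ i) → ℝ)
    (v : (i : ι) → ((j : ι) → Θ j) → ((j : ι) → A j) → ℝ) (ε : ℝ)
    (π : ((i : ι) → Θ i) → ((i : ι) → A i) → ℝ) : Prop :=
  ∀ (i : ι) (φ : Θ i → A i → A i),
    ∑ θ, ρ θ * ∑ a : (j : ι) → A j, π θ a * v i θ a ≥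
      ∑ θ, ρ θ * ∑ a : (j : ι) → A j,
        π θ a * v i θ (Function.update a i (φ (θ i) (a i))) - ε

/-- `Π_SF^ε` : images under `η` of ε-SFCEs. -/
def PiSF (ρ : ((i : ι) → Θ i) → ℝ)
    (v : (i : ι) → ((j : ι) → Θ j) → ((j : ι) → A j) → ℝ) (ε : ℝ) :
    Set (((i : ι) → Θ i) → ((i : ι) → A i) → ℝ) :=
  {π | ∃ σ, IsDist σ ∧ IsSFCE ρ v ε σ ∧ eta σ = π}

/-- `Π_ANF^ε` : images under `η` of ε-ANFCEs. -/
def PiANF (ρ : ((i : ι) → Θ i) → ℝ)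
    (v : (i : ι) → ((j : ι) → Θ j) → ((j : ι) → A j) → ℝ) (ε : ℝ) :
    Set (((i : ι) → Θ i) → ((i : ι) → A i) → ℝ) :=
  {π | ∃ σ, IsDist σ ∧ IsANFCE ρ v ε σ ∧ eta σ = π}

/-- `Π_Com^ε` : ε-approximate communication equilibria. -/
def PiCom (ρ : ((i : ι) → Θ i) → ℝ)
    (v : (i : ι) → ((j : ι) → Θ j) → ((j : ι) → A j) → ℝ) (ε : ℝ) :
    Set (((i : ι) → Θ i) → ((i : ι) → A i) → ℝ) :=
  {π | (∀ θ, IsDist (π θ)) ∧ CommIncentive ρ v ε π}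

/-- `Π_BS^ε` : ε-approximate Bayesian solutions. -/
def PiBS (ρ : ((i : ι) → Θ i) → ℝ)
    (v : (i : ι) → ((j : ι) → Θ j) → ((j : ι) → A j) → ℝ) (ε : ℝ) :
    Set (((i : ι) → Θ i) → ((i : ι) → A i) → ℝ) :=
  {π | (∀ θ, IsDist (π θ)) ∧ BSIncentive ρ v ε π}

/-- `Π_BNE^ε` : ε-approximate Bayes Nash equilibria in the agent normal form. -/
def PiBNE (ρ : ((i : ι) → Θ i) → ℝ)
    (v : (i : ι) → ((j : ι) → Θ j) → ((j : ι) → A j) → ℝ) (ε : ℝ) :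
    Set (((i : ι) → Θ i) → ((i : ι) → A i) → ℝ) :=
  {π | π ∈ PiProd ∧ BSIncentive ρ v ε π}

section FiniteSums

lemma isDist_pi_prod {κ : Type*} [Fintype κ] {X : κ → Type*} [∀ j, Fintype (X j)]
    {f : (j : κ) → X j → ℝ} (hf : ∀ j, IsDist (f j)) :
    IsDist (fun x : (j : κ) → X j => ∏ j, f j (x j)) := by
  refine ⟨fun x => ⟨Finset.prod_nonneg fun j _ => ((hf j).1 _).1,
    Finset.prod_le_one (fun j _ => ((hf j).1 _).1) fun j _ => ((hf j).1 _).2⟩, ?_⟩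
  rw [← Fintype.prod_sum]
  exact Finset.prod_eq_one fun j _ => (hf j).2

lemma isDist_of_mem_piProd {κ : Type*} [Fintype κ] {Ty Ac : κ → Type*}
    [∀ j, Fintype (Ac j)] {π : ((j : κ) → Ty j) → ((j : κ) → Ac j) → ℝ}
    (hπ : π ∈ PiProd) (θ : (j : κ) → Ty j) : IsDist (π θ) := by
  obtain ⟨p, hp, hπp⟩ := hπ
  rw [funext (hπp θ)]
  exact isDist_pi_prod fun j => hp j (θ j)

/-- The marginals of a product distribution are its factors. -/
lemma sum_ite_apply_eq_prod {κ B : Type*} [Fintype κ] [Fintype B] {f : κ → B → ℝ}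
    (hf : ∀ k, IsDist (f k)) (k : κ) (b : B) :
    ∑ s : κ → B, (if s k = b then ∏ l, f l (s l) else 0) = f k b := by
  have h : ∀ s : κ → B, (if s k = b then ∏ l, f l (s l) else 0) =
      ∏ l, (if l = k → s l = b then f l (s l) else 0) := by
    intro s
    split_ifs with hs
    · exact Finset.prod_congr rfl fun l _ => by
        rw [if_pos]; rintro rfl; exact hs
    · exact (Finset.prod_eq_zero (Finset.mem_univ k) (by simp [hs])).symm
  rw [Finset.sum_congr rfl fun s _ => h s,
    ← Fintype.prod_sum (fun l c => if l = k → c = b then f l c else 0), Finset.prod_eq_single k]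
  · simp
  · intro l _ hl
    simp [hl, (hf l).2]
  · simp

/-- Under a product weight, the coordinate `i` may be drawn separately from the others, and the
factor at `i` may be replaced by any weight of total mass one. -/
lemma sum_prod_mul_eq_sum_mul_sum {κ : Type*} [Fintype κ] {X : κ → Type*} [∀ j, Fintype (X j)]
    (i : κ) (q r : (j : κ) → X j → ℝ) (hqr : ∀ j, j ≠ i → q j = r j) (hr : ∑ b, r i b = 1)
    (H : X i → ((j : κ) → X j) → ℝ) (hH : ∀ b x c, H b (Function.update x i c) = H b x) :
    ∑ x : (j : κ) → X j, (∏ j, q j (x j)) * H (x i) x =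
      ∑ b, q i b * ∑ x : (j : κ) → X j, (∏ j, r j (x j)) * H b x := by
  let e : X i × ((j : κ) → X j) → X i × ((j : κ) → X j) :=
    fun y => (y.2 i, Function.update y.2 i y.1)
  have he : Function.Involutive e := fun y => by simp [e]
  have hsplit : ∀ (f : (j : κ) → X j → ℝ) (x : (j : κ) → X j),
      ∏ j, f j (x j) = f i (x i) * ∏ j ∈ Finset.univ.erase i, f j (x j) := fun f x =>
    (Finset.mul_prod_erase _ (fun j => f j (x j)) (Finset.mem_univ i)).symm
  calc ∑ x : (j : κ) → X j, (∏ j, q j (x j)) * H (x i) x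
      = ∑ y : X i × ((j : κ) → X j), r i y.1 * ((∏ j, q j (y.2 j)) * H (y.2 i) y.2) := by
        rw [Fintype.sum_prod_type]
        simp only [← Finset.mul_sum]
        rw [← Finset.sum_mul, hr, one_mul]
    _ = ∑ y : X i × ((j : κ) → X j), q i y.1 * ((∏ j, r j (y.2 j)) * H y.1 y.2) := by
        refine Fintype.sum_equiv he.toPerm _ _ fun y => ?_
        obtain ⟨b, x⟩ := y
        simp only [Function.Involutive.coe_toPerm, e, hH, hsplit q, hsplit r,
          Function.update_self]
        have : ∏ j ∈ Finset.univ.erase i, r j (Function.update x i b j) =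
            ∏ j ∈ Finset.univ.erase i, q j (x j) :=
          Finset.prod_congr rfl fun j hj => by
            have hj := Finset.ne_of_mem_erase hj
            rw [Function.update_of_ne hj, hqr j hj]
        rw [this]
        ring
    _ = _ := by
        rw [Fintype.sum_prod_type]
        simp only [Finset.mul_sum]

end FiniteSums

section StrategyDistributions

variable {κ : Type*} [Fintype κ] {Ty Ac : κ → Type*} [∀ j, Fintype (Ty j)] [∀ j, Fintype (Ac j)]

lemma sum_eta_mul (σ : ((j : κ) → Ty j → Ac j) → ℝ) (θ : (j : κ) → Ty j)
    (F : ((j : κ) → Ac j) → ℝ) :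
    ∑ a, eta σ θ a * F a = ∑ s, σ s * F (fun j => s j (θ j)) := by
  simp only [eta, Finset.sum_mul]
  rw [Finset.sum_comm]
  refine Finset.sum_congr rfl fun s _ => ?_
  simp [ite_mul]

/-- Independent play of behavioural strategies induces the type-wise product distribution. -/
lemma eta_prod {p : (j : κ) → Ty j → Ac j → ℝ} (hp : ∀ j τ, IsDist (p j τ))
    (θ : (j : κ) → Ty j) (a : (j : κ) → Ac j) :
    eta (fun s : (j : κ) → Ty j → Ac j => ∏ j, ∏ τ, p j τ (s j τ)) θ a =
      ∏ j, p j (θ j) (a j) := by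
  have h : ∀ s : (j : κ) → Ty j → Ac j,
      (if (fun j => s j (θ j)) = a then ∏ j, ∏ τ, p j τ (s j τ) else 0) =
        ∏ j, (if s j (θ j) = a j then ∏ τ, p j τ (s j τ) else 0) := by
    intro s
    split_ifs with hs
    · exact Finset.prod_congr rfl fun j _ => by rw [if_pos (congrFun hs j)]
    · obtain ⟨j, hj⟩ := Function.ne_iff.1 hs
      exact (Finset.prod_eq_zero (Finset.mem_univ j) (if_neg hj)).symm
  simp only [eta]
  rw [Finset.sum_congr rfl fun s _ => h s,
    ← Fintype.prod_sum (fun j (t : Ty j → Ac j) => if t (θ j) = a j then ∏ τ, p j τ (t τ) else 0)]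
  exact Finset.prod_congr rfl fun j _ => sum_ite_apply_eq_prod (hp j) (θ j) (a j)

variable {ρ : ((j : κ) → Ty j) → ℝ} {v : κ → ((j : κ) → Ty j) → ((j : κ) → Ac j) → ℝ} {ε : ℝ}

lemma isANFCE_iff_bsIncentive_eta (σ : ((j : κ) → Ty j → Ac j) → ℝ) :
    IsANFCE ρ v ε σ ↔ BSIncentive ρ v ε (eta σ) := by
  simp only [IsANFCE, BSIncentive]
  refine forall_congr' fun i => forall_congr' fun φ => ?_
  simp only [sum_eta_mul σ _ (fun a => v i _ a),
    sum_eta_mul σ _ (fun a => v i _ (Function.update a i (φ _ (a i))))]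

lemma IsSFCE.isANFCE {σ : ((j : κ) → Ty j → Ac j) → ℝ} (h : IsSFCE ρ v ε σ) :
    IsANFCE ρ v ε σ := fun i φ => h i fun t τ => φ τ (t τ)

lemma CommIncentive.bsIncentive {π : ((j : κ) → Ty j) → ((j : κ) → Ac j) → ℝ}
    (h : CommIncentive ρ v ε π) : BSIncentive ρ v ε π := fun i φ => by
  simpa using h i id φ

/-- A Bayesian solution is robust to replacing the recommendation by an action drawn independently
of it, with a law depending on the player's type. -/
lemma BSIncentive.randomized_deviation {π : ((j : κ) → Ty j) → ((j : κ) → Ac j) → ℝ}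
    (h : BSIncentive ρ v ε π) (i : κ) [Nonempty (Ac i)] {K : Type*} [Fintype K]
    {w : Ty i → K → ℝ} (hw : ∀ τ, IsDist (w τ)) (f : Ty i → K → Ac i) :
    ∑ θ, ρ θ * ∑ a, π θ a * v i θ a ≥
      ∑ θ, ρ θ * ∑ k, w (θ i) k * ∑ a, π θ a * v i θ (Function.update a i (f (θ i) k)) - ε := by
  let g : Ty i → Ac i → ℝ := fun τ b =>
    ∑ θ with θ i = τ, ρ θ * ∑ a, π θ a * v i θ (Function.update a i b)
  choose t ht using fun τ => Finite.exists_max (g τ)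
  have hle : ∑ θ, ρ θ * ∑ k, w (θ i) k * ∑ a, π θ a * v i θ (Function.update a i (f (θ i) k)) ≤
      ∑ θ, ρ θ * ∑ a, π θ a * v i θ (Function.update a i (t (θ i))) := by
    rw [← Finset.sum_fiberwise Finset.univ (fun θ => θ i),
      ← Finset.sum_fiberwise Finset.univ (fun θ => θ i)
        (fun θ => ρ θ * ∑ a, π θ a * v i θ (Function.update a i (t (θ i))))]
    refine Finset.sum_le_sum fun τ _ => ?_
    calc ∑ θ with θ i = τ, ρ θ * ∑ k, w (θ i) k *
            ∑ a, π θ a * v i θ (Function.update a i (f (θ i) k))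
        = ∑ θ with θ i = τ, ∑ k, w τ k *
            (ρ θ * ∑ a, π θ a * v i θ (Function.update a i (f τ k))) := by
          refine Finset.sum_congr rfl fun θ hθ => ?_
          rw [(Finset.mem_filter.1 hθ).2, Finset.mul_sum]
          exact Finset.sum_congr rfl fun k _ => by ring
      _ = ∑ k, w τ k * g τ (f τ k) := by
          rw [Finset.sum_comm]
          simp only [g, Finset.mul_sum]
      _ ≤ ∑ k, w τ k * g τ (t τ) := Finset.sum_le_sum fun k _ =>
          mul_le_mul_of_nonneg_left (ht τ _) ((hw τ).1 k).1
      _ = g τ (t τ) := by rw [← Finset.sum_mul, (hw τ).2, one_mul]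
      _ = _ := by
          refine Finset.sum_congr rfl fun θ hθ => ?_
          rw [(Finset.mem_filter.1 hθ).2]
  have := h i fun τ _ => t τ
  linarith

lemma BSIncentive.commIncentive [∀ j, Nonempty (Ac j)]
    {π : ((j : κ) → Ty j) → ((j : κ) → Ac j) → ℝ}
    (h : BSIncentive ρ v ε π) (hπ : π ∈ PiProd) : CommIncentive ρ v ε π := by
  obtain ⟨p, hp, hπp⟩ := hπ
  intro i ψ φ
  convert h.randomized_deviation i (fun τ => hp i (ψ τ)) φ using 5 with θ
  simp only [hπp]
  have := sum_prod_mul_eq_sum_mul_sum i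
    (fun j => p j (Function.update θ i (ψ (θ i)) j)) (fun j => p j (θ j))
    (fun j hj => by simp only [Function.update_of_ne hj]) (hp i (θ i)).2
    (fun b a => v i θ (Function.update a i (φ (θ i) b))) (by simp)
  simpa only [Function.update_self] using this

lemma BSIncentive.isSFCE_prod [∀ j, Nonempty (Ac j)] {p : (j : κ) → Ty j → Ac j → ℝ}
    (hp : ∀ j τ, IsDist (p j τ))
    (h : BSIncentive ρ v ε (fun θ a => ∏ j, p j (θ j) (a j))) :
    IsSFCE ρ v ε (fun s => ∏ j, ∏ τ, p j τ (s j τ)) := by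
  intro i φ
  have heta : eta (fun s : (j : κ) → Ty j → Ac j => ∏ j, ∏ τ, p j τ (s j τ)) =
      fun θ a => ∏ j, p j (θ j) (a j) := funext₂ (eta_prod hp)
  rw [← heta] at h
  have hq : ∀ j, IsDist (fun t : Ty j → Ac j => ∏ τ, p j τ (t τ)) :=
    fun j => isDist_pi_prod (hp j)
  convert h.randomized_deviation i (fun _ => hq i) (fun τ t => φ t τ) using 5 with θ _ θ
  · exact (sum_eta_mul _ θ _).symm
  · simp only [sum_eta_mul _ _ (fun a => v i _ (Function.update a i _))]
    refine sum_prod_mul_eq_sum_mul_sum i (fun j (t : Ty j → Ac j) => ∏ τ, p j τ (t τ))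
      (fun j (t : Ty j → Ac j) => ∏ τ, p j τ (t τ)) (fun _ _ => rfl) (hq i).2
      (fun t s => v i θ (Function.update (fun j => s j (θ j)) i (φ t (θ i)))) fun t s c => ?_
    congr 1
    ext j
    by_cases hj : j = i
    · subst hj; simp
    · simp [hj]

lemma exists_isSFCE_of_mem_piBNE [∀ j, Nonempty (Ac j)]
    {π : ((j : κ) → Ty j) → ((j : κ) → Ac j) → ℝ} (h : π ∈ PiBNE ρ v ε) :
    ∃ σ, IsDist σ ∧ IsSFCE ρ v ε σ ∧ eta σ = π := by
  obtain ⟨⟨p, hp, hπp⟩, hBS⟩ := h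
  obtain rfl : π = fun θ a => ∏ j, p j (θ j) (a j) := funext₂ hπp
  exact ⟨_, isDist_pi_prod fun j => isDist_pi_prod (hp j), hBS.isSFCE_prod hp,
    funext₂ (eta_prod hp)⟩

end StrategyDistributions

/-- `Π_SF^ε ∩ Π_Prod = Π_ANF^ε ∩ Π_Prod = Π_Com^ε ∩ Π_Prod = Π_BS^ε ∩ Π_Prod = Π_BNE^ε`. -/
theorem product_equilibria_coincide
    (ρ : ((i : ι) → Θ i) → ℝ) (hρ : IsDist ρ)
    (v : (i : ι) → ((j : ι) → Θ j) → ((j : ι) → A j) → ℝ)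
    (hv : ∀ i θ a, v i θ a ∈ Set.Icc (0 : ℝ) 1)
    (ε : ℝ) (hε : 0 ≤ ε) :
    PiSF ρ v ε ∩ PiProd = PiBNE ρ v ε ∧
    PiANF ρ v ε ∩ PiProd = PiBNE ρ v ε ∧
    PiCom ρ v ε ∩ PiProd = PiBNE ρ v ε ∧
    PiBS ρ v ε ∩ PiProd = PiBNE ρ v ε := by
  refine ⟨?_, ?_, ?_, ?_⟩ <;> ext π <;> constructor
  · rintro ⟨⟨σ, -, hσ, rfl⟩, hπ⟩
    exact ⟨hπ, (isANFCE_iff_bsIncentive_eta σ).1 hσ.isANFCE⟩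
  · exact fun h => ⟨exists_isSFCE_of_mem_piBNE h, h.1⟩
  · rintro ⟨⟨σ, -, hσ, rfl⟩, hπ⟩
    exact ⟨hπ, (isANFCE_iff_bsIncentive_eta σ).1 hσ⟩
  · intro h
    obtain ⟨σ, hd, hσ, hη⟩ := exists_isSFCE_of_mem_piBNE h
    exact ⟨⟨σ, hd, hσ.isANFCE, hη⟩, h.1⟩
  · exact fun h => ⟨h.2, h.1.2.bsIncentive⟩
  · exact fun h => ⟨⟨isDist_of_mem_piProd h.1, h.2.commIncentive h.1⟩, h.1⟩
  · exact fun h => ⟨h.2, h.1.2⟩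
  · exact fun h => ⟨⟨isDist_of_mem_piProd h.1, h.2⟩, h.1⟩
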